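/- arXiv:2511.00575 — 2 statements merged into one kernel-verified Lean document; each statement's English description precedes it below -/
import Mathlib

section
/- Let n be a natural number with n ≥ 3. The cycle graph C_n on n vertices is Perrin cordial if and only if n ≢ 2 (mod 4). -/
/-- The reindexed Perrin sequence: `P 0 = 0`, `P 1 = 3`, `P 2 = 0`, `P 3 = 2`,
and `P n = P (n-2) + P (n-3)` thereafter
(so `P 4 = 3`, `P 5 = 2`, `P 6 = 5`, ...). -/
def perrin : ℕ → ℕ
  | 0 => 0
  | 1 => 3
  | 2 => 0
  | 3 => 2
  | n + 4 => perrin (n + 2) + perrin (n + 1)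

/-- The induced edge label: `f` assigns to each vertex the index of a Perrin number,
and an edge `uv` gets the label `(P (f u) + P (f v)) mod 2`. -/
def perrinEdgeLabel {V : Type*} (f : V → ℕ) : Sym2 V → ℕ :=
  Sym2.lift ⟨fun u v => (perrin (f u) + perrin (f v)) % 2, fun u v => by simp [Nat.add_comm]⟩

/-- `eCount G f i` is the number of edges of `G` whose induced label under `f` is `i`. -/
noncomputable def eCount {V : Type*} (G : SimpleGraph V) (f : V → ℕ) (i : ℕ) : ℕ :=
  {e | e ∈ G.edgeSet ∧ perrinEdgeLabel f e = i}.ncard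

/-- A finite simple graph `G` on `N` vertices is Perrin cordial if there is an injective
labeling of its vertices by indices in `{0, 1, ..., N}` such that the numbers of edges
with induced label `0` and `1` differ by at most `1`. -/
def IsPerrinCordial {V : Type*} [Fintype V] (G : SimpleGraph V) : Prop :=
  ∃ f : V → Fin (Fintype.card V + 1), Function.Injective f ∧
    |(eCount G (fun v => (f v : ℕ)) 0 : ℤ) - (eCount G (fun v => (f v : ℕ)) 1 : ℤ)| ≤ 1

open Finset in
/-- For `n ≥ 3`, the edges of the cycle graph are the pairs `s(i, i + 1)`, without repetition. -/
theorem eCount_cycleGraph (m : ℕ) (f : Fin (m + 3) → ℕ) (c : ℕ) :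
    eCount (SimpleGraph.cycleGraph (m + 3)) f c =
      #{i : Fin (m + 3) | (perrin (f i) + perrin (f (i + 1))) % 2 = c} := by
  have hinj : Function.Injective fun i : Fin (m + 3) => s(i, i + 1) := by
    intro i j h
    rcases Sym2.eq_iff.1 h with ⟨h, -⟩ | ⟨h₁, h₂⟩
    · exact h
    · rw [h₁, add_assoc, add_eq_left] at h₂
      simp [Fin.ext_iff, Fin.val_add, Nat.mod_eq_of_lt] at h₂
  rw [← Set.ncard_coe_finset, ← Set.ncard_image_of_injective _ hinj, eCount]
  congr 1
  ext e
  induction e with | _ u v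
  simp only [Set.mem_ofPred_eq, SimpleGraph.mem_edgeSet, SimpleGraph.cycleGraph_adj, Set.mem_image,
    coe_filter, mem_univ, true_and, perrinEdgeLabel, Sym2.lift_mk, Sym2.eq_iff]
  constructor
  · rintro ⟨h | h, hc⟩
    · obtain rfl : u = v + 1 := by rw [← h]; abel
      exact ⟨v, by rwa [add_comm (perrin (f v))], Or.inr ⟨rfl, rfl⟩⟩
    · obtain rfl : v = u + 1 := by rw [← h]; abel
      exact ⟨u, hc, Or.inl ⟨rfl, rfl⟩⟩
  · rintro ⟨i, hi, ⟨rfl, rfl⟩ | ⟨rfl, rfl⟩⟩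
    · exact ⟨Or.inr (by abel), hi⟩
    · exact ⟨Or.inl (by abel), by rwa [add_comm (perrin (f (i + 1)))]⟩

open Finset in
theorem eCount_cycleGraph_zero_add_one (m : ℕ) (f : Fin (m + 3) → ℕ) :
    eCount (SimpleGraph.cycleGraph (m + 3)) f 0 + eCount (SimpleGraph.cycleGraph (m + 3)) f 1 =
      m + 3 := by
  have h := card_filter_add_card_filter_not (s := (univ : Finset (Fin (m + 3))))
    fun i => (perrin (f i) + perrin (f (i + 1))) % 2 = 0
  simpa [eCount_cycleGraph] using h

/-- The label changes parity an even number of times around a cycle. -/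
theorem even_eCount_cycleGraph_one (m : ℕ) (f : Fin (m + 3) → ℕ) :
    Even (eCount (SimpleGraph.cycleGraph (m + 3)) f 1) := by
  have hmod (a : ℕ) : (if a % 2 = 1 then 1 else 0) = a % 2 := by split_ifs <;> omega
  rw [eCount_cycleGraph, Finset.card_filter, Nat.even_iff]
  simp only [hmod]
  have hshift := Equiv.sum_comp (Equiv.addRight (1 : Fin (m + 3))) fun i => perrin (f i)
  simp only [Equiv.coe_addRight] at hshift
  rw [← Finset.sum_nat_mod, Finset.sum_add_distrib, hshift]
  omega

theorem perrin_add_seven_mod_two (n : ℕ) : perrin (n + 8) % 2 = perrin (n + 1) % 2 := by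
  have h (k : ℕ) : perrin (k + 4) = perrin (k + 2) + perrin (k + 1) := rfl
  have h₀ := h n
  have h₁ := h (n + 1)
  have h₂ := h (n + 2)
  have h₃ := h (n + 3)
  have h₄ := h (n + 4)
  simp only [add_assoc, Nat.reduceAdd] at *
  omega

theorem perrin_seven_mul_add_mod_two (q r : ℕ) :
    perrin (7 * q + (r + 1)) % 2 = perrin (r + 1) % 2 := by
  induction q with
  | zero => simp
  | succ q ih =>
    rw [show 7 * (q + 1) + (r + 1) = 7 * q + r + 8 by ring, perrin_add_seven_mod_two]
    exact ih

/-- The increasing enumeration of the indices of odd Perrin numbers. -/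
def oddPerrinIndex (j : ℕ) : ℕ :=
  7 * (j / 4) + (if j % 4 = 0 then 1 else if j % 4 = 1 then 4 else if j % 4 = 2 then 6 else 7)

/-- The increasing enumeration of the indices of even Perrin numbers. -/
def evenPerrinIndex (j : ℕ) : ℕ :=
  if j = 0 then 0 else
    7 * ((j - 1) / 3) + (if (j - 1) % 3 = 0 then 2 else if (j - 1) % 3 = 1 then 3 else 5)

theorem perrin_oddPerrinIndex (j : ℕ) : perrin (oddPerrinIndex j) % 2 = 1 := by
  unfold oddPerrinIndex
  split_ifs <;> exact perrin_seven_mul_add_mod_two _ _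

theorem perrin_evenPerrinIndex (j : ℕ) : perrin (evenPerrinIndex j) % 2 = 0 := by
  unfold evenPerrinIndex
  split_ifs
  · rfl
  all_goals exact perrin_seven_mul_add_mod_two _ _

theorem oddPerrinIndex_injective : Function.Injective oddPerrinIndex := by
  intro i j h
  unfold oddPerrinIndex at h
  split_ifs at h <;> omega

theorem evenPerrinIndex_injective : Function.Injective evenPerrinIndex := by
  intro i j h
  unfold evenPerrinIndex at h
  split_ifs at h <;> omega

theorem oddPerrinIndex_ne_evenPerrinIndex (i j : ℕ) : oddPerrinIndex i ≠ evenPerrinIndex j := by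
  intro h
  have hi := perrin_oddPerrinIndex i
  rw [h, perrin_evenPerrinIndex] at hi
  omega

/-- The number of odd Perrin numbers of index at most `n`. -/
def oddPerrinCount (n : ℕ) : ℕ :=
  4 * (n / 7) + (if n % 7 = 0 then 0 else if n % 7 < 4 then 1 else if n % 7 < 6 then 2 else 3)

theorem oddPerrinIndex_le {n j : ℕ} (h : j < oddPerrinCount n) : oddPerrinIndex j ≤ n := by
  unfold oddPerrinCount at h
  unfold oddPerrinIndex
  split_ifs at h ⊢ <;> omega

theorem evenPerrinIndex_le {n j : ℕ} (h : j + oddPerrinCount n ≤ n) : evenPerrinIndex j ≤ n := by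
  unfold oddPerrinCount at h
  unfold evenPerrinIndex
  split_ifs at h ⊢ <;> omega

theorem le_oddPerrinCount (n : ℕ) : (n + 1) / 4 ≤ oddPerrinCount n := by
  unfold oddPerrinCount
  split_ifs <;> omega

theorem add_oddPerrinCount_le (n : ℕ) : (n + 1) / 4 + oddPerrinCount n ≤ n := by
  unfold oddPerrinCount
  split_ifs <;> omega

/-- Labels of even and odd parity alternate on the first `2 * k` positions, then come odd labels
up to a total of `c`, then even labels. -/
def alternatingLabel (k c i : ℕ) : ℕ :=
  if i < 2 * k then if i % 2 = 0 then evenPerrinIndex (i / 2) else oddPerrinIndex (i / 2)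
  else if i < k + c then oddPerrinIndex (i - k) else evenPerrinIndex (i - c)

theorem alternatingLabel_injective (k c : ℕ) : Function.Injective (alternatingLabel k c) := by
  intro i j h
  unfold alternatingLabel at h
  split_ifs at h
  all_goals first
    | exact absurd h (oddPerrinIndex_ne_evenPerrinIndex _ _)
    | exact absurd h.symm (oddPerrinIndex_ne_evenPerrinIndex _ _)
    | have := oddPerrinIndex_injective h; omega
    | have := evenPerrinIndex_injective h; omega

theorem alternatingLabel_le {n k i : ℕ} (hk : k ≤ oddPerrinCount n)
    (hkn : k + oddPerrinCount n ≤ n) (hi : i < n) :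
    alternatingLabel k (oddPerrinCount n) i ≤ n := by
  unfold alternatingLabel
  split_ifs
  · exact evenPerrinIndex_le (by omega)
  · exact oddPerrinIndex_le (by omega)
  · exact oddPerrinIndex_le (by omega)
  · exact evenPerrinIndex_le (by omega)

theorem perrin_alternatingLabel (k c i : ℕ) :
    perrin (alternatingLabel k c i) % 2 =
      if i < 2 * k then i % 2 else if i < k + c then 1 else 0 := by
  unfold alternatingLabel
  split_ifs <;> simp only [perrin_oddPerrinIndex, perrin_evenPerrinIndex] <;> omega

open Finset in
theorem eCount_alternatingLabel {m k c : ℕ} (hk : 0 < k) (hc : k ≤ c) (hkc : k + c ≤ m + 3) :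
    eCount (SimpleGraph.cycleGraph (m + 3)) (fun i => alternatingLabel k c i) 1 = 2 * k := by
  have hset : ({i : Fin (m + 3) | (perrin (alternatingLabel k c i) +
      perrin (alternatingLabel k c (i + 1 : Fin (m + 3)))) % 2 = 1} : Finset _).map
        Fin.valEmbedding = insert (k + c - 1) (range (2 * k - 1)) := by
    have key (i : Fin (m + 3)) : (perrin (alternatingLabel k c i) +
        perrin (alternatingLabel k c (i + 1 : Fin (m + 3)))) % 2 = 1 ↔
          (i : ℕ) = k + c - 1 ∨ (i : ℕ) < 2 * k - 1 := by
      have hi := i.isLt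
      rw [Nat.add_mod, perrin_alternatingLabel, perrin_alternatingLabel, Fin.val_add_one]
      simp only [Fin.ext_iff, Fin.val_last]
      split_ifs <;> first | omega | simp only [false_iff]; omega
    ext j
    simp only [mem_map, mem_filter, mem_univ, true_and, key, Fin.valEmbedding_apply, mem_insert,
      mem_range]
    constructor
    · rintro ⟨i, hi, rfl⟩
      exact hi
    · intro hj
      exact ⟨⟨j, by omega⟩, hj, rfl⟩
  rw [eCount_cycleGraph, ← card_map Fin.valEmbedding, hset, card_insert_of_notMem, card_range]
  · omega
  · simp only [mem_range]
    omega

/-- for `n ≥ 3`, the cycle graph `C n` is Perrin cordial iff `n ≢ 2 (mod 4)`. -/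
theorem cycleGraph_isPerrinCordial_iff (n : ℕ) (hn : 3 ≤ n) :
    IsPerrinCordial (SimpleGraph.cycleGraph n) ↔ ¬ n % 4 = 2 := by
  obtain ⟨m, rfl⟩ := Nat.exists_eq_add_of_le' hn
  constructor
  · rintro ⟨f, -, hf⟩ h
    have hsum := eCount_cycleGraph_zero_add_one m fun v => (f v : ℕ)
    obtain ⟨r, hr⟩ := even_eCount_cycleGraph_one m fun v => (f v : ℕ)
    rw [abs_le] at hf
    omega
  · intro h
    have hk := le_oddPerrinCount (m + 3)
    have hkn := add_oddPerrinCount_le (m + 3)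
    set k := (m + 3 + 1) / 4 with hk_def
    refine ⟨fun i => ⟨alternatingLabel k (oddPerrinCount (m + 3)) i, ?_⟩, ?_, ?_⟩
    · rw [Fintype.card_fin]
      exact Nat.lt_succ_of_le (alternatingLabel_le hk hkn i.isLt)
    · intro i j hij
      exact Fin.ext (alternatingLabel_injective _ _ (Fin.ext_iff.1 hij))
    · have hone := eCount_alternatingLabel (m := m) (by omega) hk hkn
      have hsum := eCount_cycleGraph_zero_add_one m
        fun i => alternatingLabel k (oddPerrinCount (m + 3)) i
      simp only [abs_le]
      omega
end

section
/- For every natural number n ≥ 3, the wheel graph W_n is Perrin cordial. -/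
/-- The wheel graph `W n`: the apex `none` is adjacent to every cycle vertex `some i`,
and the vertices `some 0, some 1, ..., some (n-1)` form a cycle. -/
def wheelGraph (n : ℕ) : SimpleGraph (Option (Fin n)) :=
  SimpleGraph.fromRel (fun a b =>
    a = none ∨ ∃ i j : Fin n, a = some i ∧ b = some j ∧ (i.val + 1) % n = j.val)

open Finset

lemma exists_odd_perrin_of_three_consecutive (m : ℕ) :
    perrin (m + 1) % 2 = 1 ∨ perrin (m + 2) % 2 = 1 ∨ perrin (m + 3) % 2 = 1 := by
  induction m with
  | zero => simp [perrin]
  | succ m ih =>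
    have h : perrin (m + 4) = perrin (m + 2) + perrin (m + 1) := rfl
    simp only [show m + 1 + 1 = m + 2 from rfl, show m + 1 + 2 = m + 3 from rfl,
      show m + 1 + 3 = m + 4 from rfl]
    omega

lemma le_three_mul_count_odd_perrin (m : ℕ) :
    m + 5 ≤ 3 * Nat.count (fun k => perrin k % 2 = 1) (m + 5) := by
  induction m using Nat.strong_induction_on with
  | _ m ih =>
    match m with
    | 0 => decide
    | 1 => decide
    | 2 => decide
    | m + 3 =>
      have h := ih m (by omega)
      have hodd := exists_odd_perrin_of_three_consecutive (m + 4)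
      have hcount : Nat.count (fun k => perrin k % 2 = 1) (m + 3 + 5) =
          Nat.count (fun k => perrin k % 2 = 1) (m + 5) + (if perrin (m + 5) % 2 = 1 then 1 else 0)
          + (if perrin (m + 6) % 2 = 1 then 1 else 0)
          + (if perrin (m + 7) % 2 = 1 then 1 else 0) := by
        rw [show m + 3 + 5 = m + 5 + 1 + 1 + 1 by ring]
        simp only [Nat.count_succ]
      simp only [show m + 4 + 1 = m + 5 from rfl, show m + 4 + 2 = m + 6 from rfl,
        show m + 4 + 3 = m + 7 from rfl] at hodd
      split_ifs at hcount <;> omega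

lemma card_filter_fin_eq_count (p : ℕ → Prop) [DecidablePred p] (n : ℕ) :
    #{i : Fin n | p i} = Nat.count p n := by
  rw [Nat.count_eq_card_filter_range, card_filter, card_filter,
    Fin.sum_univ_eq_sum_range (fun i => if p i then 1 else 0)]

lemma count_lt_three_mul_and_mod_three_ne {c n r : ℕ} (hc : c < 3) (h : 3 * r ≤ n) :
    Nat.count (fun i => i < 3 * r ∧ i % 3 ≠ c) n = 2 * r := by
  have hcount : Nat.count (fun i => i % 3 ≠ c) (3 * r) = 2 * r := by
    clear h
    induction r with
    | zero => simp
    | succ r ih =>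
      rw [show 3 * (r + 1) = 3 * r + 1 + 1 + 1 by ring]
      simp only [Nat.count_succ, ih]
      split_ifs <;> omega
  rw [← hcount, Nat.count_eq_card_filter_range, Nat.count_eq_card_filter_range]
  congr 1
  ext i
  simp only [mem_filter, mem_range]
  omega

lemma exists_injective_forall_iff {α β : Type*} [Fintype α] [Fintype β]
    (p : α → Prop) (q : β → Prop) [DecidablePred p] [DecidablePred q]
    (hpos : #{a | p a} ≤ #{b | q b}) (hneg : #{a | ¬ p a} ≤ #{b | ¬ q b}) :
    ∃ f : α → β, Function.Injective f ∧ ∀ a, q (f a) ↔ p a := by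
  obtain ⟨g⟩ : Nonempty ({a // p a} ↪ {b // q b}) :=
    Function.Embedding.nonempty_of_card_le (by simpa only [Fintype.card_subtype] using hpos)
  obtain ⟨g'⟩ : Nonempty ({a // ¬ p a} ↪ {b // ¬ q b}) :=
    Function.Embedding.nonempty_of_card_le (by simpa only [Fintype.card_subtype] using hneg)
  have hf (a : α) : q (if h : p a then (g ⟨a, h⟩ : β) else g' ⟨a, h⟩) ↔ p a := by
    split_ifs with h
    · exact iff_of_true (g ⟨a, h⟩).2 h
    · exact iff_of_false (g' ⟨a, h⟩).2 h
  refine ⟨fun a => if h : p a then (g ⟨a, h⟩ : β) else g' ⟨a, h⟩, fun a b hab => ?_, hf⟩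
  have hiff : p a ↔ p b := by
    rw [← hf a, ← hf b]
    exact iff_of_eq (congrArg q hab)
  by_cases ha : p a
  · simp only [ha, hiff.1 ha, dite_true] at hab
    exact congrArg Subtype.val (g.injective (Subtype.ext hab))
  · simp only [ha, mt hiff.2 ha, dite_false] at hab
    exact congrArg Subtype.val (g'.injective (Subtype.ext hab))

/-- The cyclic successor on `Fin n`. -/
def cyclicSucc {n : ℕ} (i : Fin n) : Fin n := ⟨(i + 1) % n, Nat.mod_lt _ i.pos⟩

lemma val_cyclicSucc {n : ℕ} (i : Fin n) :
    (cyclicSucc i : ℕ) = if (i : ℕ) + 1 = n then 0 else (i : ℕ) + 1 := by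
  split_ifs with h
  · simp [cyclicSucc, h]
  · exact Nat.mod_eq_of_lt (by omega)

/-- The edges of the wheel: spokes on the left, rim edges on the right. -/
def wheelEdge (n : ℕ) : Fin n ⊕ Fin n → Sym2 (Option (Fin n))
  | .inl i => s(none, some i)
  | .inr i => s(some i, some (cyclicSucc i))

lemma wheelEdge_injective {n : ℕ} (hn : 3 ≤ n) : Function.Injective (wheelEdge n) := by
  rintro (i | i) (j | j) h
  · simpa [wheelEdge] using h
  · simp [wheelEdge] at h
  · simp [wheelEdge] at h
  · simp only [wheelEdge, Sym2.eq_iff, Option.some.injEq, Fin.ext_iff, val_cyclicSucc] at h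
    congr 1
    ext
    split_ifs at h <;> omega

lemma edgeSet_wheelGraph {n : ℕ} (hn : 3 ≤ n) :
    (wheelGraph n).edgeSet = Set.range (wheelEdge n) := by
  ext e
  induction e with
  | _ a b =>
    rw [Set.mem_range]
    constructor
    · rw [SimpleGraph.mem_edgeSet, wheelGraph, SimpleGraph.fromRel_adj]
      rintro ⟨hne, (rfl | ⟨i, j, rfl, rfl, h⟩) | (rfl | ⟨i, j, rfl, rfl, h⟩)⟩
      · cases b with
        | none => exact absurd rfl hne
        | some i => exact ⟨.inl i, rfl⟩
      · exact ⟨.inr i, by rw [wheelEdge, show cyclicSucc i = j from Fin.ext h]⟩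
      · cases a with
        | none => exact absurd rfl hne
        | some i => exact ⟨.inl i, Sym2.eq_swap⟩
      · exact ⟨.inr i, by rw [wheelEdge, show cyclicSucc i = j from Fin.ext h, Sym2.eq_swap]⟩
    · rintro ⟨i | i, h⟩
      · simp [← h, wheelEdge, wheelGraph]
      · rw [← h, wheelEdge, wheelGraph, SimpleGraph.mem_edgeSet, SimpleGraph.fromRel_adj]
        refine ⟨?_, .inl (.inr ⟨i, _, rfl, rfl, rfl⟩)⟩
        rw [Ne, Option.some.injEq, Fin.ext_iff, val_cyclicSucc]
        split_ifs <;> omega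

lemma eCount_wheelGraph {n : ℕ} (hn : 3 ≤ n) (f : Option (Fin n) → ℕ) (c : ℕ) :
    eCount (wheelGraph n) f c =
      #{i : Fin n | (perrin (f none) + perrin (f (some i))) % 2 = c} +
      #{i : Fin n | (perrin (f (some i)) + perrin (f (some (cyclicSucc i)))) % 2 = c} := by
  have himage : {e | e ∈ (wheelGraph n).edgeSet ∧ perrinEdgeLabel f e = c} =
      wheelEdge n '' {x | perrinEdgeLabel f (wheelEdge n x) = c} := by
    rw [edgeSet_wheelGraph hn]
    ext e
    simp only [Set.mem_ofPred_eq, Set.mem_range, Set.mem_image]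
    constructor
    · rintro ⟨⟨x, rfl⟩, h⟩
      exact ⟨x, h, rfl⟩
    · rintro ⟨x, h, rfl⟩
      exact ⟨⟨x, rfl⟩, h⟩
  rw [eCount, himage, Set.ncard_image_of_injective _ (wheelEdge_injective hn),
    Set.ncard_eq_toFinset_card', Set.toFinset_ofPred, card_filter, Fintype.sum_sum_type,
    card_filter, card_filter]
  rfl

/-- the wheel graph `W n` (`n ≥ 3`) is Perrin cordial. -/
theorem wheelGraph_isPerrinCordial (n : ℕ) (hn : 3 ≤ n) :
    IsPerrinCordial (wheelGraph n) := by
  have hodd := le_three_mul_count_odd_perrin (n - 3)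
  rw [show n - 3 + 5 = n + 2 by omega, ← card_filter_fin_eq_count] at hodd
  have hsum := card_filter_add_card_filter_not (s := (univ : Finset (Fin (n + 2))))
    (fun k => perrin k % 2 = 1)
  have heven : 0 < #{k : Fin (n + 2) | ¬ perrin k % 2 = 1} :=
    card_pos.2 ⟨0, by simp [perrin]⟩
  rw [card_univ, Fintype.card_fin] at hsum
  -- The rim pattern is odd, even, even repeated `r` times, followed by odd labels only.
  obtain ⟨r, hr⟩ : ∃ r, r = (#{k : Fin (n + 2) | ¬ perrin k % 2 = 1} - 1) / 2 := ⟨_, rfl⟩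
  have hrn : 3 * r ≤ n := by omega
  let p : Option (Fin n) → Prop := fun v =>
    ∃ i, v = some i ∧ ¬ ((i : ℕ) < 3 * r ∧ (i : ℕ) % 3 ≠ 0)
  have p_none : ¬ p none := by simp [p]
  have p_some (i : Fin n) : p (some i) ↔ ¬ ((i : ℕ) < 3 * r ∧ (i : ℕ) % 3 ≠ 0) := by simp [p]
  classical
  have hrim : #{i : Fin n | ¬ p (some i)} = 2 * r := by
    simp only [p_some, not_not]
    rw [card_filter_fin_eq_count (fun i => i < 3 * r ∧ i % 3 ≠ 0),
      count_lt_three_mul_and_mod_three_ne (by norm_num) hrn]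
  have hturn : #{i : Fin n | ¬ (p (some i) ↔ p (some (cyclicSucc i)))} = 2 * r := by
    rw [← count_lt_three_mul_and_mod_three_ne (c := 1) (by norm_num) hrn,
      ← card_filter_fin_eq_count]
    congr 1
    ext i
    simp only [mem_filter, mem_univ, true_and, p_some, val_cyclicSucc]
    split_ifs <;> omega
  have hneg : #{v | ¬ p v} = 2 * r + 1 := by
    rw [card_filter, Fintype.sum_option, if_pos p_none, ← card_filter, hrim, add_comm]
  have hpos : #{v | p v} + #{v | ¬ p v} = n + 1 := by
    rw [card_filter_add_card_filter_not, card_univ, Fintype.card_option, Fintype.card_fin]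
  have hcard : Fintype.card (Option (Fin n)) + 1 = n + 2 := by simp
  obtain ⟨f, hf, hfp⟩ := exists_injective_forall_iff p
    (fun k : Fin (n + 2) => perrin k % 2 = 1) (by omega) (by omega)
  refine ⟨fun v => Fin.cast hcard.symm (f v), (Fin.cast_injective _).comp hf, ?_⟩
  have hspoke0 : #{i : Fin n | (perrin (f none) + perrin (f (some i))) % 2 = 0} = 2 * r := by
    rw [← hrim]
    congr 1
    ext i
    have h := hfp none
    simp only [mem_filter, mem_univ, true_and, ← hfp] at p_none ⊢
    omega
  have hrim1 : #{i : Fin n | (perrin (f (some i)) + perrin (f (some (cyclicSucc i)))) % 2 = 1} =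
      2 * r := by
    rw [← hturn]
    congr 1
    ext i
    simp only [mem_filter, mem_univ, true_and, ← hfp]
    omega
  have hspoke := card_filter_add_card_filter_not (s := (univ : Finset (Fin n)))
    (fun i => (perrin (f none) + perrin (f (some i))) % 2 = 0)
  have hrim' := card_filter_add_card_filter_not (s := (univ : Finset (Fin n)))
    (fun i => (perrin (f (some i)) + perrin (f (some (cyclicSucc i)))) % 2 = 0)
  simp only [Nat.mod_two_ne_zero, card_univ, Fintype.card_fin] at hspoke hrim'
  simp only [eCount_wheelGraph hn, Fin.val_cast]
  rw [abs_le]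
  omega
end
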